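/- Fix n ∈ ℕ, an edge set E ⊆ {(i,j) : 1 ≤ i < j ≤ n}, and biases θ ∈ ℝ^n. The set of couplings Γ ∈ ℝ^E for which there exist two minimizers z, z' of z ↦ 𝖤(θ,Γ,z) over {−1,1}^n with z_i z_j ≠ z'_i z'_j for some edge (i,j) ∈ E has Lebesgue measure zero in ℝ^E. -/

import Mathlib

open Finset MeasureTheory Filter Topology

namespace IsingML

/-- The set of spin configurations `{-1,1}^n`. -/
def spins (n : ℕ) : Set (Fin n → ℝ) := {z | ∀ i, z i = 1 ∨ z i = -1}

/-- The Ising energy `𝖤(θ,Γ,z) = ∑_i θ_i z_i + ∑_{(i,j)∈E} Γ_ij z_i z_j`. -/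
def energy {n : ℕ} (E : Finset (Fin n × Fin n)) (θ : Fin n → ℝ) (Γ : {e // e ∈ E} → ℝ)
    (z : Fin n → ℝ) : ℝ :=
  ∑ i, θ i * z i + ∑ e : {e // e ∈ E}, Γ e * z e.1.1 * z e.1.2

/-- The ground-state energy `𝖤₀(θ,Γ) = min_{z ∈ {-1,1}^n} 𝖤(θ,Γ,z)`. -/
noncomputable def groundEnergy {n : ℕ} (E : Finset (Fin n × Fin n)) (θ : Fin n → ℝ)
    (Γ : {e // e ∈ E} → ℝ) : ℝ :=
  sInf (energy E θ Γ '' spins n)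

/-- `z` is a minimizer (ground state) of the Ising energy. -/
def IsMinimizer {n : ℕ} (E : Finset (Fin n × Fin n)) (θ : Fin n → ℝ) (Γ : {e // e ∈ E} → ℝ)
    (z : Fin n → ℝ) : Prop :=
  z ∈ spins n ∧ ∀ z' ∈ spins n, energy E θ Γ z ≤ energy E θ Γ z'

/-- An affine hyperplane `{x | ∑ i, x i * a i = c}` with `a ≠ 0` is Lebesgue-null. -/
lemma volume_hyperplane_eq_zero {ι : Type*} [Fintype ι] (a : ι → ℝ) (ha : a ≠ 0) (c : ℝ) :
    (volume : Measure (ι → ℝ)) {x | ∑ i, x i * a i = c} = 0 := by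
  classical
  let S : AffineSubspace ℝ (ι → ℝ) :=
    { carrier := {x | ∑ i, x i * a i = c}
      smul_vsub_vadd_mem' := by
        intro t x y z hx hy hz
        simp only [Set.mem_ofPred_eq] at hx hy hz ⊢
        simp only [vsub_eq_sub, vadd_eq_add, Pi.add_apply, Pi.smul_apply, Pi.sub_apply,
          smul_eq_mul, add_mul, sub_mul, mul_assoc, Finset.sum_add_distrib, ← Finset.mul_sum,
          Finset.sum_sub_distrib, hx, hy, hz]
        ring }
  refine Measure.addHaar_affineSubspace volume S fun hS => ha ?_
  have hmem : ∀ x : ι → ℝ, ∑ i, x i * a i = c := fun x => by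
    have hx : x ∈ S := hS ▸ AffineSubspace.mem_top ℝ _ x
    exact hx
  have hc : c = 0 := by simpa using (hmem 0).symm
  funext j
  simpa [Pi.single_apply, hc] using hmem (Pi.single j 1)

lemma finite_spins (n : ℕ) : (spins n).Finite :=
  (Set.Finite.pi' fun _ : Fin n => Set.toFinite ({1, -1} : Set ℝ)).subset fun _ hz => hz

/-- Two configurations with different edge products have equal energy only on a null set of
couplings. -/
lemma volume_energy_eq_energy {n : ℕ} (E : Finset (Fin n × Fin n)) (θ : Fin n → ℝ)
    (z z' : Fin n → ℝ) (e : {e // e ∈ E}) (he : z e.1.1 * z e.1.2 ≠ z' e.1.1 * z' e.1.2) :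
    (volume : Measure ({e // e ∈ E} → ℝ)) {Γ | energy E θ Γ z = energy E θ Γ z'} = 0 := by
  refine measure_mono_null ?_ (volume_hyperplane_eq_zero
    (fun e : {e // e ∈ E} => z e.1.1 * z e.1.2 - z' e.1.1 * z' e.1.2)
    (fun h => he (sub_eq_zero.mp (congrFun h e))) (∑ i, θ i * z' i - ∑ i, θ i * z i))
  intro Γ hΓ
  simp only [Set.mem_ofPred_eq, energy] at hΓ ⊢
  simp only [mul_sub, Finset.sum_sub_distrib, ← mul_assoc]
  linarith

/-- the set of couplings `Γ` for which two minimizers `z, z'` of the Ising energy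
disagree on some product `z_i z_j` over an edge `(i,j) ∈ E` has Lebesgue measure zero. -/
theorem stmt4 {n : ℕ} (E : Finset (Fin n × Fin n)) (hE : ∀ e ∈ E, e.1 < e.2)
    (θ : Fin n → ℝ) :
    (volume : Measure ({e // e ∈ E} → ℝ))
      {Γ | ∃ z z' : Fin n → ℝ, IsMinimizer E θ Γ z ∧ IsMinimizer E θ Γ z' ∧
        ∃ e : {e // e ∈ E}, z e.1.1 * z e.1.2 ≠ z' e.1.1 * z' e.1.2} = 0 := by
  have hcount := (finite_spins n).countable
  refine measure_mono_null (t := ⋃ z ∈ spins n, ⋃ z' ∈ spins n,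
    {Γ | energy E θ Γ z = energy E θ Γ z' ∧
      ∃ e : {e // e ∈ E}, z e.1.1 * z e.1.2 ≠ z' e.1.1 * z' e.1.2}) ?_ ?_
  · rintro Γ ⟨z, z', hz, hz', he⟩
    simp only [Set.mem_iUnion]
    exact ⟨z, hz.1, z', hz'.1, le_antisymm (hz.2 z' hz'.1) (hz'.2 z hz.1), he⟩
  · refine (measure_biUnion_null_iff hcount).mpr fun z _ =>
      (measure_biUnion_null_iff hcount).mpr fun z' _ => ?_
    by_cases he : ∃ e : {e // e ∈ E}, z e.1.1 * z e.1.2 ≠ z' e.1.1 * z' e.1.2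
    · obtain ⟨e, he⟩ := he
      exact measure_mono_null (fun Γ hΓ => hΓ.1) (volume_energy_eq_energy E θ z z' e he)
    · simp [he]

end IsingML
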